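/- Let Γ = {f₁, f₂, f₃} be a smooth solution of the elastic network flow ∂ₜfᵢ = −∇ₛ²κᵢ − ½|κᵢ|²κᵢ + λᵢκᵢ + φᵢ ∂ₛfᵢ on (0,T) × [0,1] with the network boundary conditions. Assume: (i) there is δ ∈ (0,1] such that for each t ∈ (0,T) there exist i, j ∈ {1,2,3} with |⟨∂ₛfᵢ(t,0), ∂ₛf_j(t,0)⟩| ≤ 1 − δ; (ii) there is C₀ > 0 with L(fᵢ(t,·)) ≥ 1/C₀ and ‖κᵢ(t)‖₂ ≤ C₀ for all t ∈ (0,T) and i = 1,2,3. Then for every ℓ ∈ ℕ there is a constant C (depending on n, ℓ, δ, C₀) such that for all t ∈ (0,T) and i = 1,2,3: |φᵢ(t,0)| ≤ (C/δ) Σ_{j=1}^{3} L(f_j)^{-3} ‖κ_j‖₂^{(2ℓ−1)/(2(ℓ+2))} ‖κ_j‖_{ℓ+2,2}^{5/(2(ℓ+2))}. -/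

import Mathlib

open Set MeasureTheory
open scoped RealInnerProductSpace

noncomputable section

/-- Arc-length derivative `∂ₛ g = |∂ₓ f|⁻¹ ∂ₓ g` along the curve `f`. -/
def sDeriv {n : ℕ} {F : Type*} [NormedAddCommGroup F] [NormedSpace ℝ F]
    (f : ℝ → EuclideanSpace ℝ (Fin n)) (g : ℝ → F) (x : ℝ) : F :=
  ‖deriv f x‖⁻¹ • deriv g x

/-- The unit tangent `τ = ∂ₛ f`. -/
def tau {n : ℕ} (f : ℝ → EuclideanSpace ℝ (Fin n)) : ℝ → EuclideanSpace ℝ (Fin n) :=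
  sDeriv f f

/-- The curvature vector `κ = ∂ₛ² f`. -/
def kappa {n : ℕ} (f : ℝ → EuclideanSpace ℝ (Fin n)) : ℝ → EuclideanSpace ℝ (Fin n) :=
  sDeriv f (tau f)

/-- Normal projection of the arc-length derivative: `∇ₛψ = ∂ₛψ − ⟨∂ₛψ, τ⟩ τ`. -/
def nablaS {n : ℕ} (f ψ : ℝ → EuclideanSpace ℝ (Fin n)) (x : ℝ) :
    EuclideanSpace ℝ (Fin n) :=
  sDeriv f ψ x - ⟪sDeriv f ψ x, tau f x⟫ • tau f x

/-- Iterated normal arc-length derivative `∇ₛ^m`. -/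
def nablaSIter {n : ℕ} (f : ℝ → EuclideanSpace ℝ (Fin n)) :
    ℕ → (ℝ → EuclideanSpace ℝ (Fin n)) → ℝ → EuclideanSpace ℝ (Fin n)
  | 0, ψ => ψ
  | m + 1, ψ => nablaS f (nablaSIter f m ψ)

/-- Length of the curve `f` over `[0,1]`. -/
def curveLen {n : ℕ} (f : ℝ → EuclideanSpace ℝ (Fin n)) : ℝ :=
  ∫ x in (0 : ℝ)..1, ‖deriv f x‖

/-- Scale-invariant norm `‖∇ₛⁱκ‖_p = L(f)^{i+1-1/p} (∫₀¹ |∇ₛⁱκ|^p ds)^{1/p}`. -/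
def knorm {n : ℕ} (f : ℝ → EuclideanSpace ℝ (Fin n)) (i : ℕ) (p : ℝ) : ℝ :=
  curveLen f ^ ((i : ℝ) + 1 - 1 / p) *
    (∫ x in (0 : ℝ)..1, ‖nablaSIter f i (kappa f) x‖ ^ p * ‖deriv f x‖) ^ (1 / p)

/-- Scale-invariant norm `‖κ‖_{k,p} = Σ_{i=0}^{k} ‖∇ₛⁱκ‖_p`. -/
def knormSum {n : ℕ} (f : ℝ → EuclideanSpace ℝ (Fin n)) (k : ℕ) (p : ℝ) : ℝ :=
  ∑ i ∈ Finset.range (k + 1), knorm f i p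


/-- Partial time derivative of a time-dependent field. -/
def pT {F : Type*} [NormedAddCommGroup F] [NormedSpace ℝ F]
    (g : ℝ → ℝ → F) (t x : ℝ) : F :=
  deriv (fun s => g s x) t

lemma seq_one (D : ℝ) (hD : 0 < D) (i : ℕ) : ∃ C : ℝ, 0 < C ∧ ∀ S : ℕ → ℝ, (∀ j, 0 ≤ S j) →
    (∀ j, S (j+1) ^ 2 ≤ D * S j * S (j+2)) → S i ^ (i+1) ≤ C * S 0 * S (i+1) ^ i := by
  induction i with
  | zero => exact ⟨1, one_pos, fun S _ _ => by simp⟩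
  | succ i ih =>
    obtain ⟨C, hC, h⟩ := ih
    refine ⟨D ^ (i+1) * C, by positivity, fun S h0 hS => ?_⟩
    have h1 := h S h0 hS
    have h2 := hS i
    have a0 := h0 0
    have a1 := h0 (i+1)
    have a2 := h0 (i+2)
    have ai := h0 i
    rcases a1.eq_or_lt with hz | hp
    · rw [← hz, zero_pow (by omega)]; positivity
    · have h3 : (S (i+1) ^ 2) ^ (i+1) ≤ (D * S i * S (i+2)) ^ (i+1) :=
        pow_le_pow_left₀ (by positivity) h2 _
      have h4 : (D * S i * S (i+2)) ^ (i+1) ≤ D ^ (i+1) * (C * S 0 * S (i+1) ^ i) * S (i+2) ^ (i+1) := by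
        rw [mul_pow, mul_pow]; gcongr
      have hq : 0 < S (i+1) ^ i := by positivity
      refine le_of_mul_le_mul_right ?_ hq
      calc S (i+1) ^ (i+1+1) * S (i+1) ^ i = (S (i+1) ^ 2) ^ (i+1) := by ring
        _ ≤ _ := h3.trans h4
        _ = _ := by ring

lemma seq_two (D : ℝ) (hD : 0 < D) (i : ℕ) (hi : 1 ≤ i) (d : ℕ) : ∃ C : ℝ, 0 < C ∧ ∀ S : ℕ → ℝ,
    (∀ j, 0 ≤ S j) → (∀ j, S (j+1) ^ 2 ≤ D * S j * S (j+2)) →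
    S i ^ (i+d) ≤ C * S 0 ^ d * S (i+d) ^ i := by
  induction d with
  | zero => exact ⟨1, one_pos, fun S _ _ => by simp⟩
  | succ d ih =>
    obtain ⟨C, hC, h⟩ := ih
    obtain ⟨C', hC', h'⟩ := seq_one D hD (i+d)
    refine ⟨max 1 (C ^ (i+d+1) * C' ^ i), by positivity, fun S h0 hS => ?_⟩
    have h1 := h S h0 hS
    have h2 := h' S h0 hS
    have a0 := h0 0
    have a1 := h0 i
    have a2 := h0 (i+d)
    have a3 := h0 (i+d+1)
    set M := max 1 (C ^ (i+d+1) * C' ^ i) with hM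
    have hM1 : 1 ≤ M := le_max_left _ _
    have hM2 : C ^ (i+d+1) * C' ^ i ≤ M ^ (i+d) :=
      (le_max_right _ _).trans (le_self_pow₀ hM1 (by omega))
    have hMp : 0 < M := by linarith
    change S i ^ (i+d+1) ≤ M * S 0 ^ (d+1) * S (i+d+1) ^ i
    refine le_of_pow_le_pow_left₀ (n := i+d) (by omega) (by positivity) ?_
    calc (S i ^ (i+d+1)) ^ (i+d) = (S i ^ (i+d)) ^ (i+d+1) := by ring
      _ ≤ (C * S 0 ^ d * S (i+d) ^ i) ^ (i+d+1) := pow_le_pow_left₀ (by positivity) h1 _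
      _ = C ^ (i+d+1) * S 0 ^ (d * (i+d+1)) * (S (i+d) ^ (i+d+1)) ^ i := by
        rw [mul_pow, mul_pow, ← pow_mul, ← pow_mul, ← pow_mul]; ring
      _ ≤ C ^ (i+d+1) * S 0 ^ (d * (i+d+1)) * (C' * S 0 * S (i+d+1) ^ (i+d)) ^ i := by
        gcongr
      _ = (C ^ (i+d+1) * C' ^ i) * (S 0 ^ (d+1) * S (i+d+1) ^ i) ^ (i+d) := by
        simp only [mul_pow, ← pow_mul]; ring
      _ ≤ M ^ (i+d) * (S 0 ^ (d+1) * S (i+d+1) ^ i) ^ (i+d) := by gcongr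
      _ = _ := by rw [← mul_pow]; ring

lemma num_interp {a0 a1 a2 X : ℝ} (h0 : 0 ≤ a0) (h1 : 0 ≤ a1) (h2 : 0 ≤ a2)
    (hX2 : X ^ 2 ≤ 4 * ((a0 ^ 2 + 2 * a0 * a1) * (a1 ^ 2 + 2 * a1 * a2)))
    (h : a1 ^ 2 ≤ X + a0 * a2) : a1 ^ 2 ≤ 100 * a0 * (a0 + a1 + a2) := by
  rcases le_total a1 a0 with hc | hc
  · nlinarith [mul_nonneg h0 h1, mul_nonneg h0 h2]
  · by_contra hcon
    push Not at hcon
    have e0 : a0 * a2 ≤ a1 ^ 2 / 100 := by nlinarith [mul_nonneg h0 h1, mul_nonneg h0 h0]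
    have e1 : 99 / 100 * a1 ^ 2 ≤ X := by linarith
    have e2 : (a0 ^ 2 + 2 * a0 * a1) * (a1 ^ 2 + 2 * a1 * a2) ≤ (3 * a0 * a1) * (2 * a1 * (a1 + a2)) := by
      gcongr ?_ * ?_
      · nlinarith
      · nlinarith
    have e3 : (99 / 100 * a1 ^ 2) ^ 2 ≤ X ^ 2 := by gcongr
    have e4 : a0 * (a1 + a2) ≤ a1 ^ 2 / 100 := by nlinarith
    have e5 : (3 * a0 * a1) * (2 * a1 * (a1 + a2)) ≤ 6 / 100 * (a1 ^ 2) ^ 2 := by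
      nlinarith [mul_le_mul_of_nonneg_left e4 (sq_nonneg a1)]
    have e6 : (a1 ^ 2) ^ 2 ≤ 0 := by nlinarith
    have : a1 = 0 := by
      have : (a1 ^ 2) ^ 2 = 0 := le_antisymm e6 (by positivity)
      simpa using this
    subst this
    nlinarith [mul_nonneg h0 h0, mul_nonneg h0 h2]

lemma wCS {σ p q : ℝ → ℝ} (hσ : ContinuousOn σ (Icc 0 1)) (hp : ContinuousOn p (Icc 0 1))
    (hq : ContinuousOn q (Icc 0 1)) (h0 : ∀ x ∈ Icc (0:ℝ) 1, 0 ≤ σ x) :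
    ∫ x in (0:ℝ)..1, p x * q x * σ x ≤
      √(∫ x in (0:ℝ)..1, p x ^ 2 * σ x) * √(∫ x in (0:ℝ)..1, q x ^ 2 * σ x) := by
  have u : uIcc (0:ℝ) 1 = Icc 0 1 := uIcc_of_le zero_le_one
  have i1 : IntervalIntegrable (fun x => p x ^ 2 * σ x) volume 0 1 :=
    ContinuousOn.intervalIntegrable (by rw [u]; fun_prop)
  have i2 : IntervalIntegrable (fun x => q x ^ 2 * σ x) volume 0 1 :=
    ContinuousOn.intervalIntegrable (by rw [u]; fun_prop)
  have i3 : IntervalIntegrable (fun x => p x * q x * σ x) volume 0 1 :=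
    ContinuousOn.intervalIntegrable (by rw [u]; fun_prop)
  set A := ∫ x in (0:ℝ)..1, p x ^ 2 * σ x
  set B := ∫ x in (0:ℝ)..1, p x * q x * σ x
  set C := ∫ x in (0:ℝ)..1, q x ^ 2 * σ x
  have key : ∀ t : ℝ, 0 ≤ C * (t * t) + (2 * B) * t + A := by
    intro t
    have e : C * (t * t) + (2 * B) * t + A = ∫ x in (0:ℝ)..1, (p x + t * q x) ^ 2 * σ x := by
      have : (fun x => (p x + t * q x) ^ 2 * σ x) = fun x =>
        (q x ^ 2 * σ x) * (t * t) + (p x * q x * σ x) * (2 * t) + p x ^ 2 * σ x := by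
        funext x; ring
      rw [this, intervalIntegral.integral_add ((i2.mul_const _).add (i3.mul_const _)) i1,
        intervalIntegral.integral_add (i2.mul_const _) (i3.mul_const _),
        intervalIntegral.integral_mul_const, intervalIntegral.integral_mul_const]
      ring
    rw [e]
    exact intervalIntegral.integral_nonneg zero_le_one
      (fun x hx => mul_nonneg (sq_nonneg _) (h0 x hx))
  have hd := discrim_le_zero key
  have hA : 0 ≤ A := intervalIntegral.integral_nonneg zero_le_one
      (fun x hx => mul_nonneg (sq_nonneg _) (h0 x hx))
  unfold discrim at hd
  rw [← Real.sqrt_mul hA]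
  exact Real.le_sqrt_of_sq_le (by nlinarith)

lemma ftc_le {g g' : ℝ → ℝ} (h : ∀ x ∈ Icc (0:ℝ) 1, HasDerivAt g (g' x) x)
    (hc : ContinuousOn g' (Icc 0 1)) {x y : ℝ} (hx : x ∈ Icc (0:ℝ) 1) (hy : y ∈ Icc (0:ℝ) 1) :
    g x - g y ≤ ∫ z in (0:ℝ)..1, |g' z| := by
  have hs : uIcc y x ⊆ Icc 0 1 := by
    rw [← uIcc_of_le (zero_le_one (α := ℝ))] at *
    exact uIcc_subset_uIcc hy hx
  have e : ∫ z in y..x, g' z = g x - g y :=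
    intervalIntegral.integral_eq_sub_of_hasDerivAt (fun z hz => h z (hs hz))
      (ContinuousOn.intervalIntegrable (hc.mono hs))
  rw [← e]
  refine (le_abs_self _).trans ?_
  have i1 : IntervalIntegrable (fun z => |g' z|) volume 0 1 :=
    ContinuousOn.intervalIntegrable (by rw [uIcc_of_le zero_le_one]; exact hc.abs)
  refine (intervalIntegral.norm_integral_le_abs_integral_norm (f := g')).trans ?_
  simp only [Real.norm_eq_abs]
  rw [← abs_of_nonneg (intervalIntegral.integral_nonneg (f := fun z => |g' z|)
    (zero_le_one (α := ℝ)) (fun z _ => abs_nonneg (g' z)))]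
  refine intervalIntegral.abs_integral_mono_interval ?_ ?_ i1
  · rw [uIoc_of_le zero_le_one]
    rcases le_total y x with hh | hh
    · rw [uIoc_of_le hh]; exact Ioc_subset_Ioc hy.1 hx.2
    · rw [uIoc_of_ge hh]; exact Ioc_subset_Ioc hx.1 hy.2
  · exact Filter.Eventually.of_forall (fun z => abs_nonneg _)

section
variable {E : Type*} [NormedAddCommGroup E] [InnerProductSpace ℝ E]

/-- weighted L² norm -/
def wA (σ : ℝ → ℝ) (ψ : ℝ → E) : ℝ := √(∫ x in (0:ℝ)..1, ‖ψ x‖ ^ 2 * σ x)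

lemma sup_est {σ : ℝ → ℝ} {ψ v : ℝ → E} (hσ : ContinuousOn σ (Icc 0 1))
    (hψ : ContinuousOn ψ (Icc 0 1)) (hv : ContinuousOn v (Icc 0 1))
    (h0 : ∀ x ∈ Icc (0:ℝ) 1, 0 ≤ σ x)
    (hd : ∀ x ∈ Icc (0:ℝ) 1, HasDerivAt (fun x => ‖ψ x‖ ^ 2) (2 * σ x * ⟪ψ x, v x⟫) x)
    {x : ℝ} (hx : x ∈ Icc (0:ℝ) 1) :
    (∫ x in (0:ℝ)..1, σ x) * ‖ψ x‖ ^ 2 ≤ wA σ ψ ^ 2 + 2 * (∫ x in (0:ℝ)..1, σ x) * wA σ ψ * wA σ v := by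
  have u : uIcc (0:ℝ) 1 = Icc 0 1 := uIcc_of_le zero_le_one
  have hin : ContinuousOn (fun x => 2 * σ x * ⟪ψ x, v x⟫) (Icc 0 1) :=
    (continuousOn_const.mul hσ).mul (hψ.inner hv)
  have c1 : ∫ z in (0:ℝ)..1, |2 * σ z * ⟪ψ z, v z⟫| ≤ 2 * (wA σ ψ * wA σ v) := by
    calc ∫ z in (0:ℝ)..1, |2 * σ z * ⟪ψ z, v z⟫| ≤ ∫ z in (0:ℝ)..1, 2 * (‖ψ z‖ * ‖v z‖ * σ z) := by
          refine intervalIntegral.integral_mono_on zero_le_one ?_ ?_ ?_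
          · exact ContinuousOn.intervalIntegrable (by rw [u]; exact hin.abs)
          · exact ContinuousOn.intervalIntegrable (by rw [u]; fun_prop)
          · intro z hz
            rw [abs_mul, abs_mul, abs_of_nonneg (h0 z hz), abs_two]
            have := abs_real_inner_le_norm (ψ z) (v z)
            nlinarith [mul_le_mul_of_nonneg_left this (h0 z hz)]
      _ = 2 * ∫ z in (0:ℝ)..1, ‖ψ z‖ * ‖v z‖ * σ z := intervalIntegral.integral_const_mul _ _
      _ ≤ _ := by
          have := wCS hσ hψ.norm hv.norm h0
          unfold wA; linarith
  have hI : wA σ ψ ^ 2 = ∫ x in (0:ℝ)..1, ‖ψ x‖ ^ 2 * σ x :=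
    Real.sq_sqrt (intervalIntegral.integral_nonneg zero_le_one
      (fun x hx => mul_nonneg (sq_nonneg _) (h0 x hx)))
  have i0 : IntervalIntegrable σ volume 0 1 := ContinuousOn.intervalIntegrable (by rw [u]; exact hσ)
  have i1 : IntervalIntegrable (fun x => ‖ψ x‖ ^ 2 * σ x) volume 0 1 :=
    ContinuousOn.intervalIntegrable (by rw [u]; fun_prop)
  have : ∫ y in (0:ℝ)..1, σ y * ‖ψ x‖ ^ 2 ≤
      ∫ y in (0:ℝ)..1, (‖ψ y‖ ^ 2 * σ y + σ y * (2 * (wA σ ψ * wA σ v))) := by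
    refine intervalIntegral.integral_mono_on zero_le_one (i0.mul_const _) (i1.add (i0.mul_const _)) ?_
    intro y hy
    have := (ftc_le hd hin hx hy).trans c1
    nlinarith [mul_le_mul_of_nonneg_left this (h0 y hy)]
  rw [intervalIntegral.integral_add i1 (i0.mul_const _), intervalIntegral.integral_mul_const,
    intervalIntegral.integral_mul_const, ← hI] at this
  linarith

lemma bdry_est {σ : ℝ → ℝ} {ψ v w : ℝ → E} (hσ : ContinuousOn σ (Icc 0 1))
    (hψ : ContinuousOn ψ (Icc 0 1)) (hv : ContinuousOn v (Icc 0 1)) (hw : ContinuousOn w (Icc 0 1))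
    (h0 : ∀ x ∈ Icc (0:ℝ) 1, 0 ≤ σ x)
    (hd : ∀ x ∈ Icc (0:ℝ) 1, HasDerivAt (fun x => ⟪ψ x, v x⟫)
      (σ x * (‖v x‖ ^ 2 + ⟪ψ x, w x⟫)) x) :
    wA σ v ^ 2 ≤ ‖ψ 1‖ * ‖v 1‖ + ‖ψ 0‖ * ‖v 0‖ + wA σ ψ * wA σ w := by
  have u : uIcc (0:ℝ) 1 = Icc 0 1 := uIcc_of_le zero_le_one
  have hI : wA σ v ^ 2 = ∫ x in (0:ℝ)..1, ‖v x‖ ^ 2 * σ x :=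
    Real.sq_sqrt (intervalIntegral.integral_nonneg zero_le_one
      (fun x hx => mul_nonneg (sq_nonneg _) (h0 x hx)))
  have cin : ContinuousOn (fun x => ⟪ψ x, w x⟫) (Icc 0 1) := hψ.inner hw
  have i1 : IntervalIntegrable (fun x => ‖v x‖ ^ 2 * σ x) volume 0 1 :=
    ContinuousOn.intervalIntegrable (by rw [u]; fun_prop)
  have i2 : IntervalIntegrable (fun x => ⟪ψ x, w x⟫ * σ x) volume 0 1 :=
    ContinuousOn.intervalIntegrable (by rw [u]; fun_prop)
  have i3 : IntervalIntegrable (fun x => σ x * (‖v x‖ ^ 2 + ⟪ψ x, w x⟫)) volume 0 1 :=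
    ContinuousOn.intervalIntegrable (by rw [u]; fun_prop)
  have e := intervalIntegral.integral_eq_sub_of_hasDerivAt (by rw [u]; exact hd) i3
  have e2 : ∫ x in (0:ℝ)..1, σ x * (‖v x‖ ^ 2 + ⟪ψ x, w x⟫) =
      (∫ x in (0:ℝ)..1, ‖v x‖ ^ 2 * σ x) + ∫ x in (0:ℝ)..1, ⟪ψ x, w x⟫ * σ x := by
    rw [← intervalIntegral.integral_add i1 i2]
    congr 1; funext x; ring
  have e3 : -∫ x in (0:ℝ)..1, ⟪ψ x, w x⟫ * σ x ≤ wA σ ψ * wA σ w := by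
    refine le_trans ?_ (wCS hσ hψ.norm hw.norm h0)
    rw [← intervalIntegral.integral_neg]
    refine intervalIntegral.integral_mono_on zero_le_one i2.neg
      (ContinuousOn.intervalIntegrable (by rw [u]; fun_prop)) ?_
    intro z hz
    have := neg_le_of_abs_le (abs_real_inner_le_norm (ψ z) (w z))
    nlinarith [mul_le_mul_of_nonneg_left this (h0 z hz)]
  have b1 := real_inner_le_norm (ψ 1) (v 1)
  have b0 := neg_le_of_abs_le (abs_real_inner_le_norm (ψ 0) (v 0))
  linarith

end

section curve
variable {n : ℕ} {f : ℝ → EuclideanSpace ℝ (Fin n)}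

lemma isOpen_reg (hf : ContDiff ℝ (⊤ : ℕ∞) f) : IsOpen {x | deriv f x ≠ 0} :=
  isOpen_ne_fun (hf.continuous_deriv (by simp)) continuous_const

lemma sDeriv_smooth (hf : ContDiff ℝ (⊤ : ℕ∞) f) {g : ℝ → EuclideanSpace ℝ (Fin n)}
    (hg : ContDiffOn ℝ (⊤ : ℕ∞) g {x | deriv f x ≠ 0}) :
    ContDiffOn ℝ (⊤ : ℕ∞) (sDeriv f g) {x | deriv f x ≠ 0} := by
  have h1 : ContDiffOn ℝ (⊤ : ℕ∞) (deriv f) {x | deriv f x ≠ 0} :=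
    hf.contDiffOn.deriv_of_isOpen (isOpen_reg hf) (by simp)
  have h2 : ContDiffOn ℝ (⊤ : ℕ∞) (deriv g) {x | deriv f x ≠ 0} :=
    hg.deriv_of_isOpen (isOpen_reg hf) (by simp)
  have h3 : ContDiffOn ℝ (⊤ : ℕ∞) (fun x => ‖deriv f x‖⁻¹) {x | deriv f x ≠ 0} :=
    (h1.norm ℝ (fun x hx => hx)).inv (fun x hx => norm_ne_zero_iff.2 hx)
  exact h3.smul h2

lemma tau_smooth (hf : ContDiff ℝ (⊤ : ℕ∞) f) :
    ContDiffOn ℝ (⊤ : ℕ∞) (tau f) {x | deriv f x ≠ 0} := sDeriv_smooth hf hf.contDiffOn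

lemma nablaS_smooth (hf : ContDiff ℝ (⊤ : ℕ∞) f) {g : ℝ → EuclideanSpace ℝ (Fin n)}
    (hg : ContDiffOn ℝ (⊤ : ℕ∞) g {x | deriv f x ≠ 0}) :
    ContDiffOn ℝ (⊤ : ℕ∞) (nablaS f g) {x | deriv f x ≠ 0} := by
  have h1 := sDeriv_smooth hf hg
  have h2 := tau_smooth hf
  exact h1.sub ((h1.inner ℝ h2).smul h2)

lemma iter_smooth (hf : ContDiff ℝ (⊤ : ℕ∞) f) (i : ℕ) :
    ContDiffOn ℝ (⊤ : ℕ∞) (nablaSIter f i (kappa f)) {x | deriv f x ≠ 0} := by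
  induction i with
  | zero => exact sDeriv_smooth hf (tau_smooth hf)
  | succ i ih => exact nablaS_smooth hf ih

lemma tau_norm {x : ℝ} (hx : deriv f x ≠ 0) : ‖tau f x‖ = 1 := by
  unfold tau sDeriv
  rw [norm_smul, norm_inv, norm_norm, inv_mul_cancel₀ (norm_ne_zero_iff.2 hx)]

lemma nablaS_normal {g : ℝ → EuclideanSpace ℝ (Fin n)} {x : ℝ} (hx : deriv f x ≠ 0) :
    ⟪nablaS f g x, tau f x⟫ = 0 := by
  unfold nablaS
  rw [inner_sub_left, real_inner_smul_left, real_inner_self_eq_norm_sq, tau_norm hx]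
  ring

lemma diffAt (hf : ContDiff ℝ (⊤ : ℕ∞) f) {g : ℝ → EuclideanSpace ℝ (Fin n)}
    (hg : ContDiffOn ℝ (⊤ : ℕ∞) g {x | deriv f x ≠ 0}) {x : ℝ} (hx : deriv f x ≠ 0) :
    HasDerivAt g (‖deriv f x‖ • sDeriv f g x) x := by
  have : ‖deriv f x‖ • sDeriv f g x = deriv g x := by
    unfold sDeriv
    rw [smul_smul, mul_inv_cancel₀ (norm_ne_zero_iff.2 hx), one_smul]
  rw [this]
  exact ((hg.differentiableOn (by simp)).differentiableAt ((isOpen_reg hf).mem_nhds hx)).hasDerivAt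

lemma kappa_normal (hf : ContDiff ℝ (⊤ : ℕ∞) f) {x : ℝ} (hx : deriv f x ≠ 0) :
    ⟪kappa f x, tau f x⟫ = 0 := by
  have h := diffAt hf (tau_smooth hf) hx
  have h2 := h.inner ℝ h
  have h3 : HasDerivAt (fun y => ⟪tau f y, tau f y⟫) 0 x := by
    refine (hasDerivAt_const x (1:ℝ)).congr_of_eventuallyEq ?_
    filter_upwards [(isOpen_reg hf).mem_nhds hx] with y hy
    rw [real_inner_self_eq_norm_sq, tau_norm hy]; norm_num
  have h4 := h2.unique h3
  rw [real_inner_smul_left, real_inner_smul_right, real_inner_comm (tau f x) ] at h4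
  have h5 : ‖deriv f x‖ ≠ 0 := norm_ne_zero_iff.2 hx
  unfold kappa
  have : ‖deriv f x‖ * ⟪sDeriv f (tau f) x, tau f x⟫ = 0 := by
    rw [real_inner_comm]; linarith
  exact (mul_eq_zero.1 this).resolve_left h5

lemma iter_normal (hf : ContDiff ℝ (⊤ : ℕ∞) f) (i : ℕ) {x : ℝ} (hx : deriv f x ≠ 0) :
    ⟪nablaSIter f i (kappa f) x, tau f x⟫ = 0 := by
  cases i with
  | zero => exact kappa_normal hf hx
  | succ i => exact nablaS_normal hx

lemma inner_sDeriv {g : ℝ → EuclideanSpace ℝ (Fin n)} {u : EuclideanSpace ℝ (Fin n)} {x : ℝ}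
    (hu : ⟪u, tau f x⟫ = 0) : ⟪sDeriv f g x, u⟫ = ⟪nablaS f g x, u⟫ := by
  unfold nablaS
  rw [inner_sub_left, real_inner_smul_left, real_inner_comm, real_inner_comm u (tau f x), hu]
  ring

/-- derivative of the inner product of two normal fields -/
lemma inner_deriv (hf : ContDiff ℝ (⊤ : ℕ∞) f) (i j : ℕ) {x : ℝ} (hx : deriv f x ≠ 0) :
    HasDerivAt (fun y => ⟪nablaSIter f i (kappa f) y, nablaSIter f j (kappa f) y⟫)
      (‖deriv f x‖ * (⟪nablaSIter f (i+1) (kappa f) x, nablaSIter f j (kappa f) x⟫ +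
        ⟪nablaSIter f i (kappa f) x, nablaSIter f (j+1) (kappa f) x⟫)) x := by
  have h := (diffAt hf (iter_smooth hf i) hx).inner ℝ (diffAt hf (iter_smooth hf j) hx)
  refine h.congr_deriv ?_
  rw [real_inner_smul_left, real_inner_smul_right, inner_sDeriv (iter_normal hf j hx),
    real_inner_comm (sDeriv f _ x), inner_sDeriv (iter_normal hf i hx),
    real_inner_comm _ (nablaS f (nablaSIter f j (kappa f)) x)]
  simp only [nablaSIter]
  ring

lemma knorm_eq (hL : 0 < curveLen f) (i : ℕ) : knorm f i 2 =
    curveLen f ^ i * √(curveLen f) * wA (fun x => ‖deriv f x‖) (nablaSIter f i (kappa f)) := by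
  unfold knorm wA
  rw [show ((i:ℝ) + 1 - 1 / 2) = (i:ℝ) + 1/2 by ring, Real.rpow_add hL, Real.rpow_natCast,
    ← Real.sqrt_eq_rpow, ← Real.sqrt_eq_rpow]
  simp only [Real.rpow_two]

lemma curve_sup (hf : ContDiff ℝ (⊤ : ℕ∞) f) (hr : ∀ x ∈ Icc (0:ℝ) 1, deriv f x ≠ 0)
    (hL : 0 < curveLen f) (i : ℕ) {x : ℝ} (hx : x ∈ Icc (0:ℝ) 1) :
    (curveLen f ^ (i+1) * ‖nablaSIter f i (kappa f) x‖) ^ 2 ≤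
      knorm f i 2 ^ 2 + 2 * knorm f i 2 * knorm f (i+1) 2 := by
  have hs : Icc (0:ℝ) 1 ⊆ {x | deriv f x ≠ 0} := hr
  have h := sup_est (σ := fun x => ‖deriv f x‖) (hf.continuous_deriv (by simp)).norm.continuousOn
    ((iter_smooth hf i).continuousOn.mono hs) ((iter_smooth hf (i+1)).continuousOn.mono hs)
    (fun x _ => norm_nonneg _) (fun x hx => by
      have := inner_deriv hf i i (hr x hx)
      simp only [real_inner_self_eq_norm_sq] at this
      convert this using 1
      rw [real_inner_comm (nablaSIter f i (kappa f) x)]; ring) hx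
  change curveLen f * _ ≤ _ + 2 * curveLen f * _ * _ at h
  rw [knorm_eq hL, knorm_eq hL]
  have hq : √(curveLen f) ^ 2 = curveLen f := Real.sq_sqrt hL.le
  generalize wA (fun x => ‖deriv f x‖) (nablaSIter f i (kappa f)) = A at *
  generalize wA (fun x => ‖deriv f x‖) (nablaSIter f (i+1) (kappa f)) = B at *
  generalize ‖nablaSIter f i (kappa f) x‖ = p at *
  generalize curveLen f = l at *
  have h2 := mul_le_mul_of_nonneg_left h (show 0 ≤ l ^ (2*i+1) by positivity)
  calc (l ^ (i+1) * p) ^ 2 = l ^ (2*i+1) * (l * p ^ 2) := by ring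
    _ ≤ _ := h2
    _ = (l ^ i * A) ^ 2 * l + 2 * l ^ (2*i) * l * A * B * l := by ring
    _ = (l ^ i * A) ^ 2 * √l ^ 2 + 2 * l ^ (2*i) * l * A * B * √l ^ 2 := by rw [hq]
    _ = _ := by ring

lemma knorm_nonneg (hL : 0 < curveLen f) (i : ℕ) : 0 ≤ knorm f i 2 := by
  rw [knorm_eq hL]; unfold wA; positivity

lemma curve_interp (hf : ContDiff ℝ (⊤ : ℕ∞) f) (hr : ∀ x ∈ Icc (0:ℝ) 1, deriv f x ≠ 0)
    (hL : 0 < curveLen f) (i : ℕ) :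
    knorm f (i+1) 2 ^ 2 ≤ 100 * knorm f i 2 * (knorm f i 2 + knorm f (i+1) 2 + knorm f (i+2) 2) := by
  have hs : Icc (0:ℝ) 1 ⊆ {x | deriv f x ≠ 0} := hr
  have h := bdry_est (σ := fun x => ‖deriv f x‖) (hf.continuous_deriv (by simp)).norm.continuousOn
    ((iter_smooth hf i).continuousOn.mono hs) ((iter_smooth hf (i+1)).continuousOn.mono hs)
    ((iter_smooth hf (i+2)).continuousOn.mono hs)
    (fun x _ => norm_nonneg _) (fun x hx => by
      have := inner_deriv hf i (i+1) (hr x hx)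
      rwa [real_inner_self_eq_norm_sq] at this)
  have p0 := curve_sup hf hr hL i (left_mem_Icc.2 zero_le_one)
  have p1 := curve_sup hf hr hL i (right_mem_Icc.2 zero_le_one)
  have q0 := curve_sup hf hr hL (i+1) (left_mem_Icc.2 zero_le_one)
  have q1 := curve_sup hf hr hL (i+1) (right_mem_Icc.2 zero_le_one)
  set P0 := curveLen f ^ (i+1) * ‖nablaSIter f i (kappa f) 0‖ with hP0
  set P1 := curveLen f ^ (i+1) * ‖nablaSIter f i (kappa f) 1‖ with hP1
  set Q0 := curveLen f ^ (i+1+1) * ‖nablaSIter f (i+1) (kappa f) 0‖ with hQ0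
  set Q1 := curveLen f ^ (i+1+1) * ‖nablaSIter f (i+1) (kappa f) 1‖ with hQ1
  refine num_interp (X := P1 * Q1 + P0 * Q0) (knorm_nonneg hL _) (knorm_nonneg hL _)
    (knorm_nonneg hL _) ?_ ?_
  · have m0 := mul_le_mul p0 q0 (sq_nonneg _) ((sq_nonneg _).trans p0)
    have m1 := mul_le_mul p1 q1 (sq_nonneg _) ((sq_nonneg _).trans p1)
    change _ ≤ _ * (knorm f (i+1) 2 ^ 2 + 2 * knorm f (i+1) 2 * knorm f (i+2) 2) at m0 m1
    nlinarith [sq_nonneg (P1 * Q1 - P0 * Q0)]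
  · rw [knorm_eq hL, knorm_eq hL, knorm_eq hL, hP0, hP1, hQ0, hQ1]
    have hq : √(curveLen f) ^ 2 = curveLen f := Real.sq_sqrt hL.le
    generalize curveLen f = l at *
    have h2 := mul_le_mul_of_nonneg_left h (show 0 ≤ l ^ (2*i+3) by positivity)
    generalize wA (fun x => ‖deriv f x‖) (nablaSIter f i (kappa f)) = A at *
    generalize wA (fun x => ‖deriv f x‖) (nablaSIter f (i+1) (kappa f)) = B at *
    generalize wA (fun x => ‖deriv f x‖) (nablaSIter f (i+2) (kappa f)) = C at *
    have e1 : (l ^ (i+1) * √l * B) ^ 2 = l ^ (2*i+3) * B ^ 2 := by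
      rw [mul_pow, mul_pow, hq]; ring
    have e2 : l ^ i * √l * A * (l ^ (i+2) * √l * C) = l ^ (2*i+3) * (A * C) := by
      calc _ = l ^ (2*i+2) * √l ^ 2 * (A * C) := by ring
        _ = _ := by rw [hq]; ring
    rw [e1, e2]
    refine h2.trans (le_of_eq ?_)
    ring

lemma knormSum_ineq (hf : ContDiff ℝ (⊤ : ℕ∞) f) (hr : ∀ x ∈ Icc (0:ℝ) 1, deriv f x ≠ 0)
    (hL : 0 < curveLen f) (i : ℕ) :
    knormSum f (i+1) 2 ^ 2 ≤ 202 * knormSum f i 2 * knormSum f (i+2) 2 := by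
  have h := curve_interp hf hr hL i
  have a0 := knorm_nonneg hL i
  have a1 := knorm_nonneg hL (i+1)
  have a2 := knorm_nonneg hL (i+2)
  have e1 : knormSum f (i+1) 2 = knormSum f i 2 + knorm f (i+1) 2 := Finset.sum_range_succ _ _
  have e2 : knormSum f (i+2) 2 = knormSum f (i+1) 2 + knorm f (i+2) 2 := Finset.sum_range_succ _ _
  have e0 : knorm f i 2 ≤ knormSum f i 2 :=
    Finset.single_le_sum (f := fun j => knorm f j 2) (fun j _ => knorm_nonneg hL j)
      (Finset.mem_range.2 (Nat.lt_succ_self i))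
  rw [e2, e1]
  generalize knormSum f i 2 = S at *
  have h3 : knorm f i 2 * (knorm f i 2 + knorm f (i+1) 2 + knorm f (i+2) 2) ≤
    S * (S + knorm f (i+1) 2 + knorm f (i+2) 2) := by gcongr; linarith
  have hS : 0 ≤ S := by linarith
  nlinarith [mul_nonneg hS a1, mul_nonneg hS a2, sq_nonneg (S - knorm f (i+1) 2)]

end curve

lemma root_lemma (ℓ : ℕ) (hℓ : 1 ≤ ℓ) {Z K S0 S M : ℝ} (hM : M = max 1 K)
    (h0 : 0 ≤ S0) (hS : 0 ≤ S)
    (h : Z ^ (2 * (ℓ + 2)) ≤ K * (S0 ^ (2 * ℓ - 1) * S ^ 5)) :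
    Z ≤ M * (S0 ^ ((2 * (ℓ : ℝ) - 1) / (2 * ((ℓ : ℝ) + 2))) * S ^ (5 / (2 * ((ℓ : ℝ) + 2)))) := by
  have hM1 : 1 ≤ M := hM ▸ le_max_left _ _
  have hM2 : K ≤ M ^ (2 * (ℓ + 2)) :=
    (hM ▸ le_max_right _ _ : K ≤ M).trans (le_self_pow₀ hM1 (by omega))
  refine le_of_pow_le_pow_left₀ (n := 2 * (ℓ + 2)) (by omega) (by positivity) ?_
  have hk : (2 * ((ℓ : ℝ) + 2)) ≠ 0 := by positivity
  have r1 : (S0 ^ ((2 * (ℓ : ℝ) - 1) / (2 * ((ℓ : ℝ) + 2)))) ^ (2 * (ℓ + 2)) = S0 ^ (2 * ℓ - 1) := by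
    rw [← Real.rpow_mul_natCast h0, ← Real.rpow_natCast S0]
    congr 1
    push_cast [Nat.cast_sub (show 1 ≤ 2 * ℓ by omega)]
    field_simp
  have r2 : (S ^ (5 / (2 * ((ℓ : ℝ) + 2)))) ^ (2 * (ℓ + 2)) = S ^ 5 := by
    rw [← Real.rpow_mul_natCast hS, ← Real.rpow_natCast S 5]
    congr 1
    push_cast
    field_simp
  rw [mul_pow, mul_pow, r1, r2]
  exact h.trans (by gcongr)

lemma second_est (ℓ : ℕ) (hℓ : 1 ≤ ℓ) : ∃ K : ℝ, 0 < K ∧ ∀ (n : ℕ)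
    (f : ℝ → EuclideanSpace ℝ (Fin n)), ContDiff ℝ (⊤ : ℕ∞) f →
    (∀ x ∈ Icc (0:ℝ) 1, deriv f x ≠ 0) → 0 < curveLen f →
    ‖nablaSIter f 2 (kappa f) 0‖ ≤ K * (curveLen f ^ (-3 : ℝ)
      * knorm f 0 2 ^ ((2 * (ℓ : ℝ) - 1) / (2 * ((ℓ : ℝ) + 2)))
      * knormSum f (ℓ + 2) 2 ^ (5 / (2 * ((ℓ : ℝ) + 2)))) := by
  obtain ⟨C, hC, h2⟩ := seq_two 202 (by norm_num) 2 (by norm_num) ℓ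
  obtain ⟨C', hC', h3⟩ := seq_two 202 (by norm_num) 3 (by norm_num) (ℓ - 1)
  refine ⟨max 1 (2 ^ (ℓ+2) * (C * C')), by positivity, fun n f hf hr hL => ?_⟩
  have hS0 : ∀ j, 0 ≤ knormSum f j 2 := fun j => Finset.sum_nonneg (fun j _ => knorm_nonneg hL j)
  have hS := knormSum_ineq hf hr hL
  specialize h2 (fun j => knormSum f j 2) hS0 hS
  specialize h3 (fun j => knormSum f j 2) hS0 hS
  rw [show 3 + (ℓ - 1) = ℓ + 2 by omega] at h3
  rw [show 2 + ℓ = ℓ + 2 by omega] at h2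
  have e0 : knormSum f 0 2 = knorm f 0 2 := by simp [knormSum]
  rw [e0] at h2 h3
  have hZ := curve_sup hf hr hL 2 (left_mem_Icc.2 zero_le_one)
  have b0 := knorm_nonneg hL 0
  have b1 := knorm_nonneg hL 1
  have b2 := knorm_nonneg hL 2
  have b3 := knorm_nonneg hL 3
  have e2 : knorm f 2 2 ≤ knormSum f 2 2 := by
    simp only [knormSum, Finset.sum_range_succ, Finset.range_zero, Finset.sum_empty]; linarith
  have e3 : knorm f 2 2 + knorm f 3 2 ≤ knormSum f 3 2 := by
    simp only [knormSum, Finset.sum_range_succ, Finset.range_zero, Finset.sum_empty]; linarith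
  have hZ2 : (curveLen f ^ 3 * ‖nablaSIter f 2 (kappa f) 0‖) ^ 2 ≤
      2 * (knormSum f 2 2 * knormSum f 3 2) := by
    have := mul_le_mul e2 e3 (by positivity) (hS0 2)
    refine hZ.trans ?_
    change knorm f 2 2 ^ 2 + 2 * knorm f 2 2 * knorm f 3 2 ≤ _
    nlinarith [sq_nonneg (knorm f 2 2)]
  have hk := hS0 (ℓ+2)
  have h2' := hS0 2
  have h3' := hS0 3
  set S := knormSum f (ℓ+2) 2
  have key := root_lemma ℓ hℓ (Z := curveLen f ^ 3 * ‖nablaSIter f 2 (kappa f) 0‖)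
    (K := 2 ^ (ℓ+2) * (C * C')) (S0 := knorm f 0 2) (S := S) rfl b0 hk (by
      calc _ = ((curveLen f ^ 3 * ‖nablaSIter f 2 (kappa f) 0‖) ^ 2) ^ (ℓ+2) := by rw [← pow_mul]
        _ ≤ (2 * (knormSum f 2 2 * knormSum f 3 2)) ^ (ℓ+2) := by gcongr
        _ = 2 ^ (ℓ+2) * (knormSum f 2 2 ^ (ℓ+2) * knormSum f 3 2 ^ (ℓ+2)) := by
          rw [mul_pow, mul_pow]
        _ ≤ 2 ^ (ℓ+2) * ((C * knorm f 0 2 ^ ℓ * S ^ 2) * (C' * knorm f 0 2 ^ (ℓ-1) * S ^ 3)) := by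
          gcongr
        _ = 2 ^ (ℓ+2) * (C * C') * (knorm f 0 2 ^ (ℓ + (ℓ - 1)) * S ^ 5) := by ring
        _ = _ := by rw [show ℓ + (ℓ - 1) = 2 * ℓ - 1 by omega])
  have hl3 : curveLen f ^ (-3 : ℝ) * curveLen f ^ 3 = 1 := by
    rw [← Real.rpow_natCast, ← Real.rpow_add hL]; norm_num
  have hl : 0 ≤ curveLen f ^ (-3 : ℝ) := by positivity
  calc ‖nablaSIter f 2 (kappa f) 0‖
      = curveLen f ^ (-3 : ℝ) * (curveLen f ^ 3 * ‖nablaSIter f 2 (kappa f) 0‖) := by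
        rw [← mul_assoc, hl3, one_mul]
    _ ≤ _ := mul_le_mul_of_nonneg_left key hl
    _ = _ := by ring

lemma junction {E : Type*} [NormedAddCommGroup E] [InnerProductSpace ℝ E] {δ : ℝ}
    (hδ0 : 0 < δ) (hδ1 : δ ≤ 1) (V : E) (A τ : Fin 3 → E) (φ : Fin 3 → ℝ)
    (hV : ∀ i, V = -A i + φ i • τ i) (hτ : ∀ i, ‖τ i‖ = 1) (hA : ∀ i, ⟪A i, τ i⟫ = 0)
    (hang : ∃ i j, |⟪τ i, τ j⟫| ≤ 1 - δ) (k : Fin 3) :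
    |φ k| ≤ 2 / δ * ∑ j, ‖A j‖ := by
  have hφ : ∀ i, φ i = ⟪V, τ i⟫ := by
    intro i
    rw [hV i, inner_add_left, inner_neg_left, hA, real_inner_smul_left,
      real_inner_self_eq_norm_sq, hτ]
    ring
  have hle : ∀ i, ‖A i‖ ≤ ∑ j, ‖A j‖ := fun i =>
    Finset.single_le_sum (f := fun j => ‖A j‖) (fun j _ => norm_nonneg _) (Finset.mem_univ i)
  have hcr : ∀ i j, |φ i| ≤ ‖A j‖ + |φ j| * |⟪τ j, τ i⟫| := by
    intro i j
    rw [hφ i, hV j, inner_add_left, inner_neg_left, real_inner_smul_left]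
    refine (abs_add_le _ _).trans ?_
    rw [abs_neg, abs_mul]
    have := abs_real_inner_le_norm (A j) (τ i)
    rw [hτ, mul_one] at this
    linarith
  obtain ⟨i, j, hij⟩ := hang
  set B := ∑ j, ‖A j‖
  have h1 := hcr i j
  have h2 := hcr j i
  rw [real_inner_comm] at h1
  have m1 := mul_le_mul_of_nonneg_left hij (abs_nonneg (φ i))
  have m2 := mul_le_mul_of_nonneg_left hij (abs_nonneg (φ j))
  have hi : δ * |φ i| ≤ B := by
    rcases le_total |φ i| |φ j| with hc | hc
    · nlinarith [hle i, hle j]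
    · nlinarith [hle i, hle j]
  have hVn : |φ k| ≤ ‖A i‖ + |φ i| := by
    have h3 := hcr k i
    have h4 := abs_real_inner_le_norm (τ i) (τ k)
    rw [hτ, hτ, mul_one] at h4
    have := mul_le_mul_of_nonneg_left h4 (abs_nonneg (φ i))
    linarith
  have hB : 0 ≤ B := (norm_nonneg _).trans (hle i)
  rw [div_mul_eq_mul_div, le_div_iff₀ hδ0]
  have := mul_le_mul_of_nonneg_right hδ1 hB
  nlinarith [hle i]

/-- Estimate of the tangential components at the triple junction:
`|φᵢ(t,0)| ≤ (C/δ) Σⱼ L(fⱼ)⁻³ ‖κⱼ‖₂^{(2ℓ−1)/(2(ℓ+2))} ‖κⱼ‖_{ℓ+2,2}^{5/(2(ℓ+2))}`,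
with `C = C(n, ℓ, δ, C₀)`. -/
theorem tangential_component_estimate (n : ℕ) (hn : 2 ≤ n)
    (δ : ℝ) (hδ0 : 0 < δ) (hδ1 : δ ≤ 1)
    (C₀ : ℝ) (hC₀ : 0 < C₀) (ℓ : ℕ) (hℓ : 1 ≤ ℓ) :
    ∃ C : ℝ, 0 < C ∧
      ∀ (T : ℝ), 0 < T →
      ∀ (P : Fin 3 → EuclideanSpace ℝ (Fin n)), Function.Injective P →
      ∀ (lam : Fin 3 → ℝ), (∀ i, 0 < lam i) →
      ∀ (f : Fin 3 → ℝ → ℝ → EuclideanSpace ℝ (Fin n)) (φ : Fin 3 → ℝ → ℝ → ℝ),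
        (∀ i, ContDiff ℝ (⊤ : ℕ∞) (Function.uncurry (f i))) →
        (∀ i, ContDiff ℝ (⊤ : ℕ∞) (Function.uncurry (φ i))) →
        (∀ i, ∀ t ∈ Ioo (0 : ℝ) T, ∀ x ∈ Icc (0 : ℝ) 1, deriv (f i t) x ≠ 0) →
        -- the elastic network flow
        (∀ i, ∀ t ∈ Ioo (0 : ℝ) T, ∀ x ∈ Icc (0 : ℝ) 1,
          pT (f i) t x
            = -nablaS (f i t) (nablaS (f i t) (kappa (f i t))) x
              - ((1 / 2 : ℝ) * ‖kappa (f i t) x‖ ^ 2) • kappa (f i t) x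
              + lam i • kappa (f i t) x
              + φ i t x • tau (f i t) x) →
        -- the network boundary conditions
        (∀ i, ∀ t ∈ Ioo (0 : ℝ) T, f i t 1 = P i) →
        (∀ i, ∀ t ∈ Ioo (0 : ℝ) T, kappa (f i t) 0 = 0 ∧ kappa (f i t) 1 = 0) →
        (∀ i j, ∀ t ∈ Ioo (0 : ℝ) T, f i t 0 = f j t 0) →
        (∀ t ∈ Ioo (0 : ℝ) T,
          ∑ i : Fin 3, (nablaS (f i t) (kappa (f i t)) 0 - lam i • tau (f i t) 0) = 0) →
        -- assumption (i): a uniform angle condition at the triple junction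
        (∀ t ∈ Ioo (0 : ℝ) T,
          ∃ i j : Fin 3, |⟪tau (f i t) 0, tau (f j t) 0⟫| ≤ 1 - δ) →
        -- assumption (ii): uniform bounds on lengths and curvature
        (∀ i, ∀ t ∈ Ioo (0 : ℝ) T,
          1 / C₀ ≤ curveLen (f i t) ∧ knorm (f i t) 0 2 ≤ C₀) →
        ∀ t ∈ Ioo (0 : ℝ) T, ∀ i : Fin 3,
          |φ i t 0|
            ≤ (C / δ) * ∑ j : Fin 3,
                curveLen (f j t) ^ (-3 : ℝ)
                  * knorm (f j t) 0 2 ^ ((2 * (ℓ : ℝ) - 1) / (2 * ((ℓ : ℝ) + 2)))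
                  * knormSum (f j t) (ℓ + 2) 2 ^ (5 / (2 * ((ℓ : ℝ) + 2))) := by
  obtain ⟨K, hK, hest⟩ := second_est ℓ hℓ
  refine ⟨2 * K, by positivity, ?_⟩
  intro T hT P hP lam hlam f φ hf hφ hreg hflow hend hkap hjun hbal hang hbd t ht i
  have hft : ∀ i, ContDiff ℝ (⊤ : ℕ∞) (f i t) := fun i =>
    (hf i).comp (contDiff_const.prodMk contDiff_id)
  have m0 : (0:ℝ) ∈ Icc (0:ℝ) 1 := left_mem_Icc.2 zero_le_one
  have hpT : ∀ j, pT (f 0) t 0 = pT (f j) t 0 := by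
    intro j
    unfold pT
    apply Filter.EventuallyEq.deriv_eq
    filter_upwards [Ioo_mem_nhds ht.1 ht.2] with s hs
    exact hjun 0 j s hs
  have hj := junction hδ0 hδ1 (pT (f 0) t 0)
    (fun j => nablaSIter (f j t) 2 (kappa (f j t)) 0) (fun j => tau (f j t) 0)
    (fun j => φ j t 0) (fun j => by
      rw [hpT j, hflow j t ht 0 m0, (hkap j t ht).1]
      simp [nablaSIter]) (fun j => tau_norm (hreg j t ht 0 m0))
    (fun j => iter_normal (hft j) 2 (hreg j t ht 0 m0)) (hang t ht) i
  refine hj.trans ?_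
  have hsum := Finset.sum_le_sum (s := Finset.univ) (fun j (_ : j ∈ Finset.univ) =>
    hest n (f j t) (hft j) (hreg j t ht)
      (lt_of_lt_of_le (by positivity) (hbd j t ht).1))
  rw [← Finset.mul_sum] at hsum
  refine (mul_le_mul_of_nonneg_left hsum (by positivity : 0 ≤ 2 / δ)).trans (le_of_eq ?_)
  ring
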